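/- For every strict partition μ with more than n nonzero parts, there exists a strict partition ν with |ν| = |μ| − (n+1)(n+2)/2 such that the shifted Littlewood–Richardson coefficient f^μ_{λ(n),ν} is nonzero; equivalently, there exists a shifted Littlewood–Richardson tableau of skew shifted shape μ/λ(n) whose content ν is a strict partition. -/

import Mathlib

noncomputable section

open scoped Classical

/-! Shifted tableaux and the shifted Littlewood–Richardson rule, following
Stembridge and the appendix of Brown–Kujawa, "Webs of type Q".

A letter of the marked alphabet `{1' < 1 < 2' < 2 < ⋯}` is encoded as a pair
`(a, m) : ℕ × Bool` with unmarked value `a ≥ 1`, where `m = true` means the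
letter is marked (`a'`). -/

/-- The strict order on the marked alphabet: `a' < a < (a+1)'`. -/
def MLt (x y : ℕ × Bool) : Prop :=
  x.1 < y.1 ∨ (x.1 = y.1 ∧ x.2 = true ∧ y.2 = false)

/-- The weak order on the marked alphabet. -/
def MLe (x y : ℕ × Bool) : Prop := MLt x y ∨ x = y

/-- A strict partition, encoded as its (strictly decreasing) list of nonzero
parts. -/
def StrictPartList (l : List ℕ) : Prop :=
  l.Chain' (· > ·) ∧ ∀ x ∈ l, 0 < x

/-- The `r`-th part (0-indexed), with value `0` beyond the length. -/
def nthPart (l : List ℕ) (r : ℕ) : ℕ := l.getD r 0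

/-- The box in row `r` and column `c` (both 0-indexed) belongs to the skew
shifted frame `[μ/λ]` (row `r` of `[μ]` occupies columns `r, …, r + μ_r − 1`). -/
def InSkew (mu la : List ℕ) (r c : ℕ) : Prop :=
  r < mu.length ∧ r + nthPart la r ≤ c ∧ c < r + nthPart mu r

/-- `T` is a shifted tableau of skew shape `μ/λ` (with entries from the marked
alphabet): rows and columns weakly increase, each row contains at most one
marked letter `a'` for each `a`, each column contains at most one unmarked
letter `a` for each `a`, and all entries are letters (value `≥ 1`). -/
structure IsShiftedTableau (mu la : List ℕ) (T : ℕ → ℕ → ℕ × Bool) : Prop where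
  pos : ∀ r c, InSkew mu la r c → 1 ≤ (T r c).1
  row_le : ∀ r c, InSkew mu la r c → InSkew mu la r (c + 1) → MLe (T r c) (T r (c + 1))
  col_le : ∀ r c, InSkew mu la r c → InSkew mu la (r + 1) c → MLe (T r c) (T (r + 1) c)
  row_marked : ∀ r c c' a, InSkew mu la r c → InSkew mu la r c' → c ≠ c' →
    ¬(T r c = (a, true) ∧ T r c' = (a, true))
  col_unmarked : ∀ r r' c a, InSkew mu la r c → InSkew mu la r' c → r ≠ r' →
    ¬(T r c = (a, false) ∧ T r' c = (a, false))

/-- The number of entries of `T` (in the skew shifted frame `[μ/λ]`) whose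
unmarked value is `i`; `fun i => content mu la T i` is the content of `T`. -/
def content (mu la : List ℕ) (T : ℕ → ℕ → ℕ × Bool) (i : ℕ) : ℕ :=
  ((Finset.range mu.length ×ˢ Finset.range (mu.length + mu.sum)).filter
    (fun p => InSkew mu la p.1 p.2 ∧ (T p.1 p.2).1 = i)).card

/-- The `r`-th row of `T` read from left to right. -/
def rowWord (mu la : List ℕ) (T : ℕ → ℕ → ℕ × Bool) (r : ℕ) : List (ℕ × Bool) :=
  (List.range (r + nthPart mu r)).filterMap
    (fun c => if InSkew mu la r c then some (T r c) else none)

/-- The word of `T`: rows read left to right, from the bottom row up. -/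
def wordOf (mu la : List ℕ) (T : ℕ → ℕ → ℕ × Bool) : List (ℕ × Bool) :=
  ((List.range mu.length).reverse).flatMap (rowWord mu la T)

/-- Stembridge's statistics `m_i(j)` for a word `w` of length `n`: for
`0 ≤ j ≤ n` the multiplicity of the unmarked letter `i` among the last `j`
letters of `w`; for `n < j ≤ 2n`, `m_i(n)` plus the multiplicity of the marked
letter `i'` among the first `j − n` letters of `w`. -/
def mStat (w : List (ℕ × Bool)) (i j : ℕ) : ℕ :=
  if j ≤ w.length then
    ((w.drop (w.length - j)).filter (fun x => x = (i, false))).length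
  else
    ((w.filter (fun x => x = (i, false))).length
      + ((w.take (j - w.length)).filter (fun x => x = (i, true))).length)

/-- Stembridge's lattice property for a word `w` in the marked alphabet
(letters of `w` are 1-indexed as `w_1 ⋯ w_n` in the conditions below):
whenever `m_i(j) = m_{i−1}(j)` then (1) if `0 ≤ j < n`, the next letter
scanned, `w_{n−j}`, is neither `i` nor `i'`; and (2) if `n ≤ j < 2n`, the next
letter scanned, `w_{j−n+1}`, is neither `i−1` (unmarked) nor `i'`. -/
def HasLattice (w : List (ℕ × Bool)) : Prop :=
  ∀ i j : ℕ, 2 ≤ i → mStat w i j = mStat w (i - 1) j →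
    (j < w.length →
      w.getD (w.length - j - 1) (0, false) ≠ (i, false)
      ∧ w.getD (w.length - j - 1) (0, false) ≠ (i, true))
    ∧ (w.length ≤ j → j < 2 * w.length →
      w.getD (j - w.length) (0, false) ≠ (i - 1, false)
      ∧ w.getD (j - w.length) (0, false) ≠ (i, true))

/-- In the word `w`, the leftmost letter of unmarked value `i` is unmarked. -/
def LeftmostUnmarked (w : List (ℕ × Bool)) (i : ℕ) : Prop :=
  ∀ (l₁ : List (ℕ × Bool)) (x : ℕ × Bool) (l₂ : List (ℕ × Bool)),
    w = l₁ ++ x :: l₂ → x.1 = i → (∀ y ∈ l₁, y.1 ≠ i) → x.2 = false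

/-- `T` is a shifted Littlewood–Richardson tableau of shape `μ/λ` and content
`ν` (so that `f^μ_{λ,ν} ≠ 0` iff such a `T` exists). -/
def IsShiftedLR (mu la nu : List ℕ) (T : ℕ → ℕ → ℕ × Bool) : Prop :=
  IsShiftedTableau mu la T
  ∧ (∀ i : ℕ, 1 ≤ i → content mu la T i = nthPart nu (i - 1))
  ∧ HasLattice (wordOf mu la T)
  ∧ (∀ i : ℕ, 1 ≤ i → i ≤ nu.length → LeftmostUnmarked (wordOf mu la T) i)

/-- The staircase strict partition `λ(n) = (n+1, n, …, 2, 1)`. -/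
def staircase (n : ℕ) : List ℕ := (List.range (n + 1)).reverse.map (· + 1)

/-- `y` comes after `x` when rows are read left to right, from the bottom row up. -/
def ReadBefore (x y : ℕ × ℕ) : Prop := y.1 < x.1 ∨ (y.1 = x.1 ∧ x.2 < y.2)

/-- `S` is flush against the column `N` for its first rows and against the main
diagonal below, and is closed under moving up and left inside that region. -/
structure IsFlushShape (N : ℕ) (S : Finset (ℕ × ℕ)) : Prop where
  le_col : ∀ r c, (r, c) ∈ S → N ≤ c
  row_le_col : ∀ r c, (r, c) ∈ S → r ≤ c
  mem_of_le : ∀ r c r' c', (r, c) ∈ S → r' ≤ r → c' ≤ c → N ≤ c' → r' ≤ c' → (r', c') ∈ S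

/-- The filling by hooks with corners `(k, k + N)`: the `k`-th hook receives the value
`k + 1`, marked in its leg and corner except in the bottom box of the column. -/
def hookFill (N : ℕ) (S : Finset (ℕ × ℕ)) (r c : ℕ) : ℕ × Bool :=
  (min r (c - N) + 1, decide (c ≤ r + N ∧ (r + 1, c) ∈ S))

theorem hookFill_eq_false {N : ℕ} {S : Finset (ℕ × ℕ)} {r c k : ℕ} :
    hookFill N S r c = (k + 1, false) ↔
      min r (c - N) = k ∧ ¬ (c ≤ r + N ∧ (r + 1, c) ∈ S) := by
  simp [hookFill, Prod.ext_iff]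

theorem hookFill_eq_true {N : ℕ} {S : Finset (ℕ × ℕ)} {r c k : ℕ} :
    hookFill N S r c = (k + 1, true) ↔
      min r (c - N) = k ∧ c ≤ r + N ∧ (r + 1, c) ∈ S := by
  simp [hookFill, Prod.ext_iff]

theorem exists_last_of_bounded (P : ℕ → Prop) (a B : ℕ) (ha : P a) (hB : ∀ b, P b → b < B) :
    ∃ b, a ≤ b ∧ P b ∧ ¬ P (b + 1) := by
  by_contra! h
  have key : ∀ m, P (a + m) := by
    intro m
    induction m with
    | zero => exact ha
    | succ m ih => exact h _ (Nat.le_add_right a m) ih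
  have := hB _ (key B)
  omega

theorem Finset.exists_forall_mem_lt (S : Finset (ℕ × ℕ)) : ∃ B, ∀ x ∈ S, x.1 < B ∧ x.2 < B := by
  refine ⟨S.sup (fun x => x.1 + x.2) + 1, fun x hx => ?_⟩
  have := Finset.le_sup (f := fun x : ℕ × ℕ => x.1 + x.2) hx
  omega

theorem Finset.card_lt_card_of_injOn_of_notMem {α : Type*} (A B : Finset α) (f : α → α) (z : α)
    (hf : ∀ y ∈ A, f y ∈ B ∧ f y ≠ z) (hinj : Set.InjOn f A) (hz : z ∈ B) :
    A.card < B.card := by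
  classical
  rw [← Finset.card_image_of_injOn hinj]
  apply Finset.card_lt_card
  rw [Finset.ssubset_iff_of_subset]
  · refine ⟨z, hz, fun h => ?_⟩
    obtain ⟨y, hy, hyz⟩ := Finset.mem_image.1 h
    exact (hf y hy).2 hyz
  · intro w hw
    obtain ⟨y, hy, rfl⟩ := Finset.mem_image.1 hw
    exact (hf y hy).1

namespace IsFlushShape

variable {N : ℕ} {S : Finset (ℕ × ℕ)}

theorem corner_mem (h : IsFlushShape N S) {r c k : ℕ} (hm : (r, c) ∈ S) (hk : k ≤ min r (c - N)) :
    (k, k + N) ∈ S := by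
  have := h.le_col r c hm
  exact h.mem_of_le r c k (k + N) hm (by omega) (by omega) (by omega) (by omega)

theorem mem_succ_col_of_lt (h : IsFlushShape N S) {r r' c : ℕ} (hm : (r, c) ∈ S) (hr : r' < r) :
    (r' + 1, c) ∈ S :=
  h.mem_of_le r c (r' + 1) c hm hr le_rfl (h.le_col _ _ hm) (by have := h.row_le_col _ _ hm; omega)

/-- In the top-down scan, unmarked letters of value `k + 2` stay strictly behind those of
value `k + 1` as long as a letter of value `k + 2` remains. -/
theorem card_unmarked_after_lt (h : IsFlushShape N S) (k r c : ℕ)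
    (hx : (r, c) ∈ S) (hxk : min r (c - N) = k + 1) :
    (S.filter (fun y => ReadBefore (r, c) y ∧ hookFill N S y.1 y.2 = (k + 2, false))).card <
      (S.filter (fun y => ReadBefore (r, c) y ∧ hookFill N S y.1 y.2 = (k + 1, false))).card := by
  have hxN := h.le_col r c hx
  have hloc : ∀ y ∈ S.filter (fun y => ReadBefore (r, c) y ∧
      hookFill N S y.1 y.2 = (k + 2, false)), y.1 = k + 1 ∧ k + 1 + N < y.2 ∧ y ∈ S := by
    rintro ⟨r', c'⟩ hy
    simp only [Finset.mem_filter, hookFill_eq_false, ReadBefore] at hy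
    obtain ⟨hyS, hb, hk, hu⟩ := hy
    have hyN := h.le_col _ _ hyS
    have : ¬ c' ≤ r' + N := by
      refine fun hle => hu ⟨hle, ?_⟩
      rcases hb with hb | hb
      · have hs := h.mem_succ_col_of_lt hx hb
        have := h.row_le_col _ _ hx
        exact h.mem_of_le _ _ _ c' hs le_rfl (by omega) hyN (by omega)
      · omega
    exact ⟨by simp only; omega, by simp only; omega, hyS⟩
  apply Finset.card_lt_card_of_injOn_of_notMem _ _ (fun y => (k, y.2)) (k, k + 1 + N)
  · intro y hy
    obtain ⟨h1, h2, h3⟩ := hloc y hy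
    refine ⟨?_, ?_⟩
    · simp only [Finset.mem_filter, hookFill_eq_false, ReadBefore]
      refine ⟨h.mem_of_le y.1 y.2 _ _ h3 (by omega) le_rfl (by omega) (by omega), by omega,
        by omega, by omega⟩
    · simp only [ne_eq, Prod.mk.injEq, true_and]
      omega
  · intro y hy z hz hyz
    obtain ⟨h1, -, -⟩ := hloc y hy
    obtain ⟨h2, -, -⟩ := hloc z hz
    simp only [Prod.mk.injEq, true_and] at hyz
    exact Prod.ext (h1.trans h2.symm) hyz
  · simp only [Finset.mem_filter, hookFill_eq_false, ReadBefore]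
    have := h.corner_mem hx hxk.ge
    refine ⟨h.mem_of_le _ _ _ _ this (by omega) le_rfl (by omega) (by omega), by omega,
        by omega, by omega⟩

theorem card_unmarked_lt (h : IsFlushShape N S) (k : ℕ) (hk : (k, k + N) ∈ S) :
    (S.filter (fun y => hookFill N S y.1 y.2 = (k + 2, false))).card <
      (S.filter (fun y => hookFill N S y.1 y.2 = (k + 1, false))).card := by
  obtain ⟨B, hB⟩ := Finset.exists_forall_mem_lt S
  obtain ⟨b, hkb, hbS, hb⟩ := exists_last_of_bounded (fun r => (r, k + N) ∈ S) k B hk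
    (fun r hr => (hB _ hr).1)
  apply Finset.card_lt_card_of_injOn_of_notMem _ _ (fun y => (k, y.2)) (b, k + N)
  · rintro ⟨r, c⟩ hy
    simp only [Finset.mem_filter, hookFill_eq_false] at hy ⊢
    have := h.le_col _ _ hy.1
    refine ⟨⟨h.mem_of_le _ _ _ _ hy.1 (by omega) le_rfl this (by omega), by omega, by omega⟩, ?_⟩
    simp only [ne_eq, Prod.mk.injEq]
    omega
  · rintro ⟨r, c⟩ hy ⟨r', c'⟩ hz hyz
    simp only [Prod.mk.injEq, true_and] at hyz
    subst hyz
    simp only [Finset.coe_filter, Set.mem_ofPred_eq, hookFill_eq_false] at hy hz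
    have := h.le_col _ _ hy.1
    rcases lt_trichotomy r r' with hlt | heq | hlt
    · exact absurd ⟨by omega, h.mem_succ_col_of_lt hz.1 hlt⟩ hy.2.2
    · rw [heq]
    · exact absurd ⟨by omega, h.mem_succ_col_of_lt hy.1 hlt⟩ hz.2.2
  · simp only [Finset.mem_filter, hookFill_eq_false]
    exact ⟨hbS, by omega, fun hc => hb hc.2⟩

theorem card_marked_before_le (h : IsFlushShape N S) (hN : 1 ≤ N) (k r c : ℕ)
    (hx : (r, c) ∈ S) (hxk : hookFill N S r c = (k + 1, false) ∨
      hookFill N S r c = (k + 2, true)) :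
    (S.filter (fun y => ReadBefore y (r, c) ∧ hookFill N S y.1 y.2 = (k + 2, true))).card ≤
      (S.filter (fun y => ReadBefore y (r, c) ∧ hookFill N S y.1 y.2 = (k + 1, true))).card := by
  rw [hookFill_eq_false, hookFill_eq_true] at hxk
  have hxN := h.le_col _ _ hx
  by_cases hd : (N + k + 1, k + 1 + N) ∈ S
  · apply Finset.card_le_card_of_injOn (fun y => (y.1 - 1, y.2 - 1))
    · rintro ⟨r', c'⟩ hy
      simp only [Finset.coe_filter, Set.mem_ofPred_eq, hookFill_eq_true, ReadBefore] at hy ⊢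
      obtain ⟨hyS, hb, hk, hle, hs⟩ := hy
      have hyN := h.le_col _ _ hyS
      have hyr := h.row_le_col _ _ hs
      have hc' : c' = k + 1 + N := by omega
      subst hc'
      have hcorner : c = k + N → (r + 1, c) ∉ S → r + 1 > N + k := by
        rintro rfl hn
        by_contra hlt
        exact hn (h.mem_of_le _ _ _ _ hd (by omega) (by omega) (by omega) (by omega))
      have hs' : (r' - 1 + 1, k + 1 + N - 1) ∈ S :=
        h.mem_of_le _ _ _ _ hs (by omega) (by omega) (by omega) (by omega)
      refine ⟨h.mem_of_le _ _ _ _ hyS (by omega) (by omega) (by omega) (by omega), ?_, by omega,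
        by omega, hs'⟩
      rcases hxk with ⟨h1, h2⟩ | ⟨h1, h2, h3⟩
      · by_cases hc : c = k + N
        · have := hcorner hc (fun h' => h2 ⟨by omega, h'⟩)
          omega
        · omega
      · omega
    · rintro ⟨r1, c1⟩ hy ⟨r2, c2⟩ hz hyz
      simp only [Finset.coe_filter, Set.mem_ofPred_eq, hookFill_eq_true] at hy hz
      simp only [Prod.mk.injEq] at hyz ⊢
      omega
  · apply Finset.card_le_card_of_injOn (fun y => (y.1, y.2 - 1))
    · rintro ⟨r', c'⟩ hy
      simp only [Finset.coe_filter, Set.mem_ofPred_eq, hookFill_eq_true, ReadBefore] at hy ⊢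
      obtain ⟨hyS, hb, hk, hle, hs⟩ := hy
      have hyN := h.le_col _ _ hyS
      have hyr := h.row_le_col _ _ hs
      have hc' : c' = k + 1 + N := by omega
      subst hc'
      have hne : r' + 1 ≠ N + k + 1 := fun he => hd (he ▸ hs)
      refine ⟨h.mem_of_le _ _ _ _ hyS (by omega) (by omega) (by omega) (by omega), by omega,
        by omega, by omega, h.mem_of_le _ _ _ _ hs (by omega) (by omega) (by omega) (by omega)⟩
    · rintro ⟨r1, c1⟩ hy ⟨r2, c2⟩ hz hyz
      simp only [Finset.coe_filter, Set.mem_ofPred_eq, hookFill_eq_true] at hy hz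
      simp only [Prod.mk.injEq] at hyz ⊢
      omega

theorem card_hook_succ_lt (h : IsFlushShape N S) (k : ℕ) (hk : (k, k + N) ∈ S) :
    (S.filter (fun y => (hookFill N S y.1 y.2).1 = k + 2)).card <
      (S.filter (fun y => (hookFill N S y.1 y.2).1 = k + 1)).card := by
  obtain ⟨B, hB⟩ := Finset.exists_forall_mem_lt S
  obtain ⟨e, hke, heS, he⟩ := exists_last_of_bounded (fun c => (k, c) ∈ S) (k + N) B hk
    (fun r hr => (hB _ hr).2)
  apply Finset.card_lt_card_of_injOn_of_notMem _ _ (fun y => (y.1 - 1, y.2 - 1)) (k, e)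
  · rintro ⟨r, c⟩ hy
    simp only [Finset.mem_filter] at hy ⊢
    simp only [hookFill] at hy ⊢
    have hc := h.le_col _ _ hy.1
    have hr := h.row_le_col _ _ hy.1
    refine ⟨⟨h.mem_of_le _ _ _ _ hy.1 (by omega) (by omega) (by omega) (by omega), by omega⟩, ?_⟩
    intro heq
    simp only [Prod.mk.injEq] at heq
    exact he (h.mem_of_le _ _ _ _ hy.1 (by omega) (by omega) (by omega) (by omega))
  · rintro ⟨r1, c1⟩ hy ⟨r2, c2⟩ hz hyz
    simp only [Finset.coe_filter, Set.mem_ofPred_eq] at hy hz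
    have := h.le_col _ _ hy.1
    have := h.le_col _ _ hz.1
    simp only [hookFill] at hy hz
    simp only [Prod.mk.injEq] at hyz ⊢
    omega
  · rw [Finset.mem_filter]
    refine ⟨heS, ?_⟩
    simp only [hookFill]
    omega

end IsFlushShape

section ReadingWords

variable {α : Type*} {R : α → α → Prop} {l : List α}

theorem List.Pairwise.mem_drop_succ_iff (hl : l.Pairwise R) (hirr : ∀ x, ¬ R x x)
    (hasymm : ∀ x y, R x y → ¬ R y x) {p : ℕ} (hp : p < l.length) (y : α) :
    y ∈ l.drop (p + 1) ↔ y ∈ l ∧ R l[p] y := by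
  have hsplit : l = l.take p ++ l[p] :: l.drop (p + 1) := by simp
  have hpw := hl
  rw [hsplit, List.pairwise_append, List.pairwise_cons] at hpw
  obtain ⟨-, ⟨h1, -⟩, h2⟩ := hpw
  refine ⟨fun hy => ⟨List.mem_of_mem_drop hy, h1 y hy⟩, fun ⟨hy, hR⟩ => ?_⟩
  rw [hsplit, List.mem_append, List.mem_cons] at hy
  rcases hy with hy | hy | hy
  · exact absurd (h2 y hy _ (List.mem_cons_self ..)) (hasymm _ _ hR)
  · exact absurd (hy ▸ hR) (hirr _)
  · exact hy

theorem List.Pairwise.mem_take_iff (hl : l.Pairwise R) (hirr : ∀ x, ¬ R x x)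
    (hasymm : ∀ x y, R x y → ¬ R y x) {p : ℕ} (hp : p < l.length) (y : α) :
    y ∈ l.take p ↔ y ∈ l ∧ R y l[p] := by
  have hsplit : l = l.take p ++ l[p] :: l.drop (p + 1) := by simp
  have hpw := hl
  rw [hsplit, List.pairwise_append, List.pairwise_cons] at hpw
  obtain ⟨-, ⟨h1, -⟩, h2⟩ := hpw
  refine ⟨fun hy => ⟨List.mem_of_mem_take hy, h2 y hy _ (List.mem_cons_self ..)⟩,
    fun ⟨hy, hR⟩ => ?_⟩
  rw [hsplit, List.mem_append, List.mem_cons] at hy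
  rcases hy with hy | hy | hy
  · exact hy
  · exact absurd (hy ▸ hR) (hirr _)
  · exact absurd hR (hasymm _ _ (h1 y hy))

theorem length_filter_map_eq_card {l : List α} (hl : l.Nodup) (f : α → ℕ × Bool) (a : ℕ × Bool)
    (A : Finset α) (hA : ∀ y, y ∈ A ↔ y ∈ l ∧ f y = a) :
    ((l.map f).filter (fun x => x = a)).length = A.card := by
  rw [List.filter_map, List.length_map, ← List.toFinset_card_of_nodup (hl.filter _)]
  congr 1
  ext y
  simp [hA]

theorem mStat_first (w : List (ℕ × Bool)) (i p : ℕ) (hp : p < w.length) :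
    mStat w i (w.length - p - 1) = ((w.drop (p + 1)).filter (fun x => x = (i, false))).length := by
  rw [mStat, if_pos (by omega)]
  congr 3
  omega

theorem mStat_second (w : List (ℕ × Bool)) (i p : ℕ) :
    mStat w i (w.length + p) = (w.filter (fun x => x = (i, false))).length +
      ((w.take p).filter (fun x => x = (i, true))).length := by
  rw [mStat]
  split_ifs with hle
  · obtain rfl : p = 0 := by omega
    simp
  · simp

/-- The lattice property of a word whose letters are indexed by a set of positions. -/
theorem hasLattice_map {S : Finset α} (f : α → ℕ × Bool) (hl : l.Pairwise R)
    (hirr : ∀ x, ¬ R x x) (hasymm : ∀ x y, R x y → ¬ R y x) (hS : ∀ y, y ∈ S ↔ y ∈ l)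
    (hfirst : ∀ i x, x ∈ S → (f x).1 = i + 2 →
      (S.filter (fun y => R x y ∧ f y = (i + 2, false))).card <
      (S.filter (fun y => R x y ∧ f y = (i + 1, false))).card)
    (hsecond : ∀ i x, x ∈ S → f x = (i + 1, false) ∨ f x = (i + 2, true) →
      (S.filter (fun y => f y = (i + 2, false))).card +
        (S.filter (fun y => R y x ∧ f y = (i + 2, true))).card <
      (S.filter (fun y => f y = (i + 1, false))).card +
        (S.filter (fun y => R y x ∧ f y = (i + 1, true))).card) :
    HasLattice (l.map f) := by
  have hnd : l.Nodup := hl.imp (by rintro a _ hab rfl; exact hirr a hab)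
  have hdrop : ∀ i p (hp : p < l.length), mStat (l.map f) i ((l.map f).length - p - 1) =
      (S.filter (fun y => R l[p] y ∧ f y = (i, false))).card := by
    intro i p hp
    rw [mStat_first _ _ _ (by simpa using hp), ← List.map_drop]
    apply length_filter_map_eq_card (hnd.sublist (List.drop_sublist ..))
    intro y
    rw [Finset.mem_filter, hS, hl.mem_drop_succ_iff hirr hasymm hp, and_assoc]
  have htake : ∀ i p (hp : p < l.length), mStat (l.map f) i ((l.map f).length + p) =
      (S.filter (fun y => f y = (i, false))).card +
      (S.filter (fun y => R y l[p] ∧ f y = (i, true))).card := by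
    intro i p hp
    rw [mStat_second, ← List.map_take]
    congr 1
    · apply length_filter_map_eq_card hnd
      intro y
      rw [Finset.mem_filter, hS]
    · apply length_filter_map_eq_card (hnd.sublist (List.take_sublist ..))
      intro y
      rw [Finset.mem_filter, hS, hl.mem_take_iff hirr hasymm hp, and_assoc]
  intro i' j hi heq
  obtain ⟨i, rfl⟩ := Nat.exists_eq_add_of_le' hi
  simp only [show i + 2 - 1 = i + 1 from rfl] at heq ⊢
  refine ⟨fun hj => ?_, fun hj1 hj2 => ?_⟩
  · obtain ⟨p, hp, rfl⟩ : ∃ p, p < l.length ∧ j = (l.map f).length - p - 1 :=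
      ⟨l.length - j - 1, by simp at hj; omega, by simp at hj ⊢; omega⟩
    rw [hdrop _ p hp, hdrop _ p hp] at heq
    have hidx : (l.map f).length - ((l.map f).length - p - 1) - 1 = p := by simp; omega
    rw [hidx, List.getD_eq_getElem _ _ (by simpa using hp), List.getElem_map]
    have := hfirst i l[p] ((hS _).2 (List.getElem_mem _))
    constructor <;> intro hc <;> rw [hc] at this <;> exact absurd heq (this rfl).ne
  · obtain ⟨p, rfl⟩ := Nat.exists_eq_add_of_le hj1
    have hp : p < l.length := by simp at hj2; omega
    rw [htake _ p hp, htake _ p hp] at heq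
    rw [Nat.add_sub_cancel_left, List.getD_eq_getElem _ _ (by simpa using hp), List.getElem_map]
    have := hsecond i l[p] ((hS _).2 (List.getElem_mem _))
    exact ⟨fun hc => absurd heq (this (Or.inl hc)).ne, fun hc => absurd heq (this (Or.inr hc)).ne⟩

end ReadingWords

/-- The boxes of `[μ/λ]` in the order in which they are read. -/
def readingCells (mu la : List ℕ) : List (ℕ × ℕ) :=
  ((List.range mu.length).reverse).flatMap fun r =>
    ((List.range (r + nthPart mu r)).filter (fun c => InSkew mu la r c)).map (fun c => (r, c))

theorem wordOf_eq_map (mu la : List ℕ) (T : ℕ → ℕ → ℕ × Bool) :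
    wordOf mu la T = (readingCells mu la).map (fun x => T x.1 x.2) := by
  rw [wordOf, readingCells, List.map_flatMap]
  congr 1
  funext r
  rw [rowWord, List.map_map, ← List.filterMap_eq_map, List.filterMap_filter]
  congr 1
  funext c
  simp

theorem mem_readingCells (mu la : List ℕ) (x : ℕ × ℕ) :
    x ∈ readingCells mu la ↔ InSkew mu la x.1 x.2 := by
  obtain ⟨r, c⟩ := x
  simp only [readingCells, List.mem_flatMap, List.mem_reverse, List.mem_range, List.mem_map,
    List.mem_filter, decide_eq_true_eq, Prod.mk.injEq]
  constructor
  · rintro ⟨r', -, c', ⟨-, h⟩, rfl, rfl⟩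
    exact h
  · intro h
    exact ⟨r, h.1, c, ⟨h.2.2, h⟩, rfl, rfl⟩

theorem pairwise_readingCells (mu la : List ℕ) :
    (readingCells mu la).Pairwise ReadBefore := by
  rw [readingCells, List.pairwise_flatMap]
  constructor
  · intro r _
    rw [List.pairwise_map]
    exact (List.pairwise_lt_range.filter _).imp (fun h => Or.inr ⟨rfl, h⟩)
  · rw [List.pairwise_reverse]
    refine List.pairwise_lt_range.imp ?_
    intro a b hab x hx y hy
    simp only [List.mem_map] at hx hy
    obtain ⟨_, -, rfl⟩ := hx
    obtain ⟨_, -, rfl⟩ := hy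
    exact Or.inl hab

/-- The set of boxes of `[μ/λ]`. -/
def skewCells (mu la : List ℕ) : Finset (ℕ × ℕ) :=
  (Finset.range mu.length ×ˢ Finset.range (mu.length + mu.sum)).filter
    (fun p => InSkew mu la p.1 p.2)

theorem nthPart_of_lt {l : List ℕ} {r : ℕ} (h : r < l.length) : nthPart l r = l[r] :=
  List.getD_eq_getElem _ _ h

theorem mem_skewCells {mu la : List ℕ} {r c : ℕ} :
    (r, c) ∈ skewCells mu la ↔ InSkew mu la r c := by
  simp only [skewCells, Finset.mem_filter, Finset.mem_product, Finset.mem_range, and_iff_right_iff_imp]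
  intro h
  have hr := h.1
  have h2 := h.2.2
  rw [nthPart_of_lt hr] at h2
  have := List.le_sum_of_mem (List.getElem_mem hr)
  omega

theorem content_eq_card (mu la : List ℕ) (T : ℕ → ℕ → ℕ × Bool) (i : ℕ) :
    content mu la T i = ((skewCells mu la).filter (fun p => (T p.1 p.2).1 = i)).card := by
  rw [content, skewCells, Finset.filter_filter]

theorem nthPart_staircase (n r : ℕ) : nthPart (staircase n) r = n + 1 - r := by
  rw [nthPart, staircase]
  by_cases h : r < n + 1
  · rw [List.getD_eq_getElem _ _ (by simpa using h)]
    simp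
    omega
  · rw [List.getD_eq_default _ _ (by simpa using h)]
    omega

theorem StrictPartList.add_nthPart_le {mu : List ℕ} (hmu : StrictPartList mu) {r s : ℕ}
    (hrs : r ≤ s) (hs : s < mu.length) : s + nthPart mu s ≤ r + nthPart mu r := by
  induction s, hrs using Nat.le_induction with
  | base => exact le_rfl
  | succ s hrs ih =>
    have h1 := ih (by omega)
    have h2 := List.isChain_iff_getElem.1 hmu.1 s hs
    rw [nthPart_of_lt hs]
    rw [nthPart_of_lt (show s < mu.length by omega)] at h1
    omega

theorem isFlushShape_skewCells {n : ℕ} {mu : List ℕ} (hmu : StrictPartList mu) :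
    IsFlushShape (n + 1) (skewCells mu (staircase n)) := by
  refine ⟨?_, ?_, ?_⟩ <;> simp only [mem_skewCells, InSkew, nthPart_staircase]
  · intros; omega
  · intros; omega
  · intro r c r' c' h hr hc hN hrc
    have := hmu.add_nthPart_le hr h.1
    omega

theorem card_skewCells {n : ℕ} {mu : List ℕ} (hmu : StrictPartList mu) (hlen : n < mu.length) :
    (skewCells mu (staircase n)).card + (n + 1) * (n + 2) / 2 = mu.sum := by
  have hfib : (skewCells mu (staircase n)).card =
      ∑ r ∈ Finset.range mu.length, (nthPart mu r - (n + 1 - r)) := by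
    rw [Finset.card_eq_sum_card_fiberwise (f := Prod.fst) (t := Finset.range mu.length)]
    · refine Finset.sum_congr rfl fun r hr => ?_
      have : (skewCells mu (staircase n)).filter (fun x => x.1 = r) =
          (Finset.Ico (r + (n + 1 - r)) (r + nthPart mu r)).image (fun c => (r, c)) := by
        ext ⟨a, b⟩
        simp only [Finset.mem_filter, mem_skewCells, InSkew, nthPart_staircase, Finset.mem_image,
          Finset.mem_Ico, Prod.mk.injEq]
        constructor
        · rintro ⟨h, rfl⟩
          exact ⟨b, h.2, rfl, rfl⟩
        · rintro ⟨b, h, rfl, rfl⟩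
          exact ⟨⟨Finset.mem_range.1 hr, h⟩, rfl⟩
      rw [this, Finset.card_image_of_injective _ (fun a b h => (Prod.mk.inj h).2), Nat.card_Ico]
      omega
    · rintro ⟨r, c⟩ h
      exact Finset.mem_coe.2 (Finset.mem_range.2 (mem_skewCells.1 h).1)
  have hle : ∀ r ∈ Finset.range mu.length, n + 1 - r ≤ nthPart mu r := by
    intro r hr
    by_cases hrn : r ≤ n
    · have h1 := hmu.add_nthPart_le hrn hlen
      have h2 := hmu.2 _ (List.getElem_mem hlen)
      rw [nthPart_of_lt hlen] at h1
      omega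
    · omega
  have hsum : ∑ r ∈ Finset.range mu.length, nthPart mu r = mu.sum := by
    rw [Finset.sum_range, ← Fin.sum_univ_getElem mu]
    exact Finset.sum_congr rfl fun i _ => nthPart_of_lt i.2
  have hstair : ∑ r ∈ Finset.range mu.length, (n + 1 - r) = (n + 1) * (n + 2) / 2 := by
    rw [← Finset.sum_subset (Finset.range_subset_range.2 (show n + 1 ≤ mu.length from hlen))
      (fun r _ hr => by simp only [Finset.mem_range] at hr; omega)]
    have h1 := Finset.sum_range_reflect (fun r => r + 1) (n + 1)
    have h2 : ∑ r ∈ Finset.range (n + 1), (n + 1 - r) =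
        ∑ r ∈ Finset.range (n + 1), (n + 1 - 1 - r + 1) :=
      Finset.sum_congr rfl fun r hr => by have := Finset.mem_range.1 hr; omega
    rw [h2, h1]
    have h3 := Finset.sum_range_succ' (fun r => r) (n + 1)
    have h4 := Finset.sum_range_id (n + 1 + 1)
    simp only [add_zero] at h3
    rw [← h3, h4, Nat.add_sub_cancel, mul_comm]
  rw [hfib, Finset.sum_tsub_distrib _ hle, hsum, hstair]
  refine Nat.sub_add_cancel ?_
  rw [← hstair, ← hsum]
  exact Finset.sum_le_sum hle

theorem isShiftedTableau_hookFill {N : ℕ} {mu la : List ℕ}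
    (h : IsFlushShape N (skewCells mu la)) :
    IsShiftedTableau mu la (hookFill N (skewCells mu la)) := by
  have key : ∀ r r' c a, (r, c) ∈ skewCells mu la → (r', c) ∈ skewCells mu la → r < r' →
      ¬(hookFill N (skewCells mu la) r c = (a + 1, false) ∧
        hookFill N (skewCells mu la) r' c = (a + 1, false)) := by
    rintro r r' c a - h2 hlt
    rw [hookFill_eq_false, hookFill_eq_false]
    rintro ⟨⟨h3, h4⟩, h5, -⟩
    exact h4 ⟨by omega, h.mem_succ_col_of_lt h2 hlt⟩
  refine ⟨?_, ?_, ?_, ?_, ?_⟩ <;> simp only [← mem_skewCells]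
  · intro r c _
    simp [hookFill]
  · intro r c h1 _
    have := h.le_col _ _ h1
    rcases lt_or_ge c (r + N) with hc | hc
    · left; left
      simp only [hookFill]
      omega
    · have hv : min r (c + 1 - N) = min r (c - N) := by omega
      have hd : ¬ (c + 1 ≤ r + N) := by omega
      simp only [hookFill, MLe, MLt, hv, hd, false_and, decide_false]
      by_cases hm : c ≤ r + N ∧ (r + 1, c) ∈ skewCells mu la <;> simp [hm]
  · intro r c h1 h2
    have := h.le_col _ _ h1
    rcases lt_or_ge r (c - N) with hc | hc
    · left; left
      simp only [hookFill]
      omega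
    · have hv : min (r + 1) (c - N) = min r (c - N) := by omega
      have hd : c ≤ r + N := by omega
      simp only [hookFill, MLe, MLt, hv, hd, h2, true_and, decide_true]
      by_cases hm : c ≤ r + 1 + N ∧ (r + 1 + 1, c) ∈ skewCells mu la <;> simp [hm]
  · rintro r c c' (_ | a) h1 h2 hne
    · simp [hookFill]
    · rw [hookFill_eq_true, hookFill_eq_true]
      have := h.le_col _ _ h1
      have := h.le_col _ _ h2
      omega
  · rintro r r' c (_ | a) h1 h2 hne
    · simp [hookFill]
    · rcases lt_or_gt_of_ne hne with hlt | hlt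
      · exact key r r' c a h1 h2 hlt
      · exact fun hc => key r' r c a h2 h1 hlt hc.symm

theorem readBefore_irrefl (x : ℕ × ℕ) : ¬ ReadBefore x x := by
  simp [ReadBefore]

theorem readBefore_asymm (x y : ℕ × ℕ) (hxy : ReadBefore x y) : ¬ ReadBefore y x := by
  simp only [ReadBefore] at *
  omega

theorem hasLattice_hookFill {N : ℕ} (hN : 1 ≤ N) {mu la : List ℕ}
    (h : IsFlushShape N (skewCells mu la)) :
    HasLattice (wordOf mu la (hookFill N (skewCells mu la))) := by
  rw [wordOf_eq_map]
  apply hasLattice_map (S := skewCells mu la) _ (pairwise_readingCells mu la) readBefore_irrefl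
    readBefore_asymm
  · rintro ⟨r, c⟩
    rw [mem_skewCells, mem_readingCells]
  · rintro i ⟨r, c⟩ hx hi
    exact h.card_unmarked_after_lt i r c hx (by simpa [hookFill] using hi)
  · rintro i ⟨r, c⟩ hx hi
    refine add_lt_add_of_lt_of_le (h.card_unmarked_lt i (h.corner_mem hx ?_))
      (h.card_marked_before_le hN i r c hx hi)
    simp only [hookFill_eq_false, hookFill_eq_true] at hi
    omega

theorem leftmostUnmarked_hookFill (N : ℕ) (mu la : List ℕ) (i : ℕ) :
    LeftmostUnmarked (wordOf mu la (hookFill N (skewCells mu la))) i := by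
  intro l₁ x l₂ hw hx hl₁
  rw [wordOf_eq_map, List.map_eq_append_iff] at hw
  obtain ⟨m₁, m, hm, rfl, hm2⟩ := hw
  obtain ⟨⟨r, c⟩, m₂, rfl, rfl, -⟩ := List.map_eq_cons_iff.1 hm2
  simp only at hx hl₁ ⊢
  have hpw := pairwise_readingCells mu la
  rw [hm, List.pairwise_append, List.pairwise_cons] at hpw
  by_contra hmark
  have hmark' : c ≤ r + N ∧ (r + 1, c) ∈ skewCells mu la := by
    simpa only [hookFill, Bool.not_eq_false, decide_eq_true_eq] using hmark
  have hmem : (r + 1, c) ∈ m₁ ++ (r, c) :: m₂ := by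
    rw [← hm, mem_readingCells]
    exact mem_skewCells.1 hmark'.2
  rw [List.mem_append, List.mem_cons] at hmem
  rcases hmem with hmem | hmem | hmem
  · refine hl₁ _ (List.mem_map_of_mem hmem) ?_
    simp only [hookFill] at hx ⊢
    omega
  · simp at hmem
  · have := hpw.2.1.1 _ hmem
    simp only [ReadBefore] at this
    omega

theorem IsFlushShape.exists_hook_count {N : ℕ} {S : Finset (ℕ × ℕ)} (h : IsFlushShape N S) :
    ∃ D, ∀ k, k < D ↔ (k, k + N) ∈ S := by
  obtain ⟨B, hB⟩ := Finset.exists_forall_mem_lt S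
  have hex : ∃ k, (k, k + N) ∉ S := ⟨B, fun hm => lt_irrefl _ (hB _ hm).1⟩
  refine ⟨Nat.find hex, fun k => ⟨fun hk => not_not.1 (Nat.find_min hex hk), fun hk => ?_⟩⟩
  by_contra hlt
  exact Nat.find_spec hex (h.corner_mem hk (by omega))

/-- Proposition A.4 of Brown–Kujawa, "Webs of type Q".
For every strict partition `μ` with more than `n` nonzero parts there is a
strict partition `ν` with `|ν| = |μ| − (n+1)(n+2)/2` and a shifted
Littlewood–Richardson tableau of skew shifted shape `μ/λ(n)` and content `ν`;
equivalently, the shifted Littlewood–Richardson coefficient `f^μ_{λ(n),ν}` is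
nonzero. -/
theorem shifted_LR_staircase_exists (n : ℕ) (mu : List ℕ)
    (hmu : StrictPartList mu) (hlen : n < mu.length) :
    ∃ (nu : List ℕ) (T : ℕ → ℕ → ℕ × Bool),
      StrictPartList nu
      ∧ nu.sum + (n + 1) * (n + 2) / 2 = mu.sum
      ∧ IsShiftedLR mu (staircase n) nu T := by
  set S := skewCells mu (staircase n) with hS
  have h : IsFlushShape (n + 1) S := isFlushShape_skewCells hmu
  obtain ⟨D, hD⟩ := h.exists_hook_count
  set T := hookFill (n + 1) S with hT
  set g : ℕ → ℕ := fun k => (S.filter (fun y => (T y.1 y.2).1 = k + 1)).card with hg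
  refine ⟨(List.range D).map g, T, ⟨?_, ?_⟩, ?_, isShiftedTableau_hookFill h, ?_,
    hasLattice_hookFill (by omega) h, fun i _ _ => leftmostUnmarked_hookFill _ _ _ i⟩
  · refine List.isChain_iff_getElem.2 fun i hi => ?_
    simp only [List.length_map, List.length_range] at hi
    simp only [List.getElem_map, List.getElem_range]
    exact h.card_hook_succ_lt i ((hD i).1 (by omega))
  · simp only [List.mem_map, List.mem_range]
    rintro _ ⟨k, hk, rfl⟩
    refine Finset.card_pos.2 ⟨(k, k + (n + 1)), Finset.mem_filter.2 ⟨(hD k).1 hk, ?_⟩⟩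
    simp [hT, hookFill]
  · rw [← card_skewCells hmu hlen, ← hS]
    congr 1
    rw [Finset.card_eq_sum_card_fiberwise (f := fun y => (T y.1 y.2).1 - 1) (t := Finset.range D),
      ← List.sum_toFinset _ List.nodup_range, List.toFinset_range]
    · refine Finset.sum_congr rfl fun k _ => ?_
      simp [hg, hT, hookFill]
    · rintro ⟨r, c⟩ hx
      simp only [Finset.coe_range, Set.mem_Iio, hT, hookFill, hD]
      exact h.corner_mem hx (by omega)
  · intro i hi
    obtain ⟨k, rfl⟩ := Nat.exists_eq_add_of_le' hi
    rw [content_eq_card, ← hS, Nat.add_sub_cancel]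
    by_cases hk : k < D
    · rw [nthPart_of_lt (by simpa using hk)]
      simp [hg]
    · rw [nthPart, List.getD_eq_default _ _ (by simpa using hk), Finset.card_eq_zero,
        Finset.filter_eq_empty_iff]
      rintro ⟨r, c⟩ hx hv
      rw [hD] at hk
      exact hk (h.corner_mem hx (by simp only [hT, hookFill] at hv; omega))
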